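/- For n ≥ 4 voters and m ≥ 4 alternatives, there is no SDS on the domain of weak preference profiles that is anonymous, neutral, ex ante efficient, and weakly strategyproof. -/

import Mathlib

open Classical Finset

/-- A weak preference relation: complete and transitive. -/
structure WeakPref (A : Type*) where
  rel : A → A → Prop
  total : ∀ a b, rel a b ∨ rel b a
  trans : ∀ {a b c}, rel a b → rel b c → rel a c

variable {A V : Type*} [Fintype A] [Fintype V]

def IsLottery (p : A → ℝ) : Prop := (∀ a, 0 ≤ p a) ∧ ∑ a, p a = 1

/-- Probability of the upper contour set `{y : y ≿ x}` under lottery `p`. -/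
noncomputable def probUC (p : A → ℝ) (r : A → A → Prop) (x : A) : ℝ :=
  ∑ y ∈ Finset.univ.filter (fun y => r y x), p y

/-- `p` (weakly) stochastically dominates `q` w.r.t. the weak relation `r`. -/
def SD (r : A → A → Prop) (p q : A → ℝ) : Prop :=
  ∀ x, probUC q r x ≤ probUC p r x

def StrictSD (r : A → A → Prop) (p q : A → ℝ) : Prop :=
  SD r p q ∧ ∃ x, probUC q r x < probUC p r x

def WeakPref.permute (π : Equiv.Perm A) (r : WeakPref A) : WeakPref A where
  rel a b := r.rel (π.symm a) (π.symm b)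
  total a b := r.total _ _
  trans h1 h2 := r.trans h1 h2

def WeakSP (f : (V → WeakPref A) → A → ℝ) : Prop :=
  ∀ R R' : V → WeakPref A, ∀ i : V,
    (∀ j, j ≠ i → R j = R' j) → ¬ StrictSD (R i).rel (f R') (f R)

def Anonymous (f : (V → WeakPref A) → A → ℝ) : Prop :=
  ∀ (π : Equiv.Perm V) (R : V → WeakPref A), f (fun i => R (π i)) = f R

def Neutral (f : (V → WeakPref A) → A → ℝ) : Prop :=
  ∀ (π : Equiv.Perm A) (R : V → WeakPref A) (x : A),
    f (fun i => (R i).permute π) (π x) = f R x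

/-- `f` is ex ante efficient: its outcome is never stochastically dominated for all
voters, strictly for at least one voter, by another lottery. -/
def ExAnteEfficient (f : (V → WeakPref A) → A → ℝ) : Prop :=
  ∀ R : V → WeakPref A,
    ¬ ∃ q : A → ℝ, IsLottery q ∧ (∀ i, SD (R i).rel q (f R)) ∧
      (∃ i, StrictSD (R i).rel q (f R))

/-- The weak preference in which alternatives of smaller rank are better. -/
def WeakPref.ofRank {A : Type*} (r : A → ℕ) : WeakPref A where
  rel a b := r a ≤ r b
  total a b := le_total (r a) (r b)
  trans h₁ h₂ := h₁.trans h₂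

/-- Complete indifference. -/
def WeakPref.indifferent (A : Type*) : WeakPref A where
  rel := fun _ _ => True
  total _ _ := Or.inl trivial
  trans _ _ := trivial

/-- Extend a preference along an embedding, with all new alternatives tied at the bottom. -/
def WeakPref.lift {A B : Type*} (e : A ↪ B) (P : WeakPref A) : WeakPref B where
  rel a b := ∀ y, b = e y → ∃ x, a = e x ∧ P.rel x y
  total a b := by
    by_cases ha : ∃ x, a = e x
    · by_cases hb : ∃ y, b = e y
      · obtain ⟨x, rfl⟩ := ha
        obtain ⟨y, rfl⟩ := hb
        refine (P.total x y).imp (fun h z hz => ⟨x, rfl, ?_⟩) (fun h z hz => ⟨y, rfl, ?_⟩)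
        · rwa [← e.injective hz]
        · rwa [← e.injective hz]
      · exact Or.inl fun y hy => (hb ⟨y, hy⟩).elim
    · exact Or.inr fun x hx => (ha ⟨x, hx⟩).elim
  trans := by
    intro a b c hab hbc z hz
    obtain ⟨y, hy, hyz⟩ := hbc z hz
    obtain ⟨x, hx, hxy⟩ := hab y hy
    exact ⟨x, hx, P.trans hxy hyz⟩

/-- Extend a profile along embeddings, with all new voters completely indifferent. -/
noncomputable def liftProfile {A B V W : Type*} (d : V ↪ W) (e : A ↪ B) (R : V → WeakPref A) :
    W → WeakPref B :=
  Function.extend d (fun v => (R v).lift e) (fun _ => WeakPref.indifferent B)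

section Lift

variable {A B V W : Type*} (d : V ↪ W) (e : A ↪ B)

@[simp]
theorem WeakPref.lift_rel_apply (P : WeakPref A) (x y : A) :
    (P.lift e).rel (e x) (e y) ↔ P.rel x y := by
  constructor
  · intro h
    obtain ⟨z, hz, hzy⟩ := h y rfl
    rwa [e.injective hz]
  · intro h z hz
    exact ⟨x, rfl, by rwa [← e.injective hz]⟩

theorem WeakPref.lift_rel_of_notMem (P : WeakPref A) {b : B} (hb : b ∉ Set.range e) (a : B) :
    (P.lift e).rel a b :=
  fun y hy => (hb ⟨y, hy.symm⟩).elim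

theorem liftProfile_apply (R : V → WeakPref A) (v : V) :
    liftProfile d e R (d v) = (R v).lift e :=
  d.injective.extend_apply _ _ _

theorem liftProfile_of_notMem (R : V → WeakPref A) {w : W} (hw : w ∉ Set.range d) :
    liftProfile d e R w = WeakPref.indifferent B :=
  Function.extend_apply' _ _ _ hw

theorem WeakPref.lift_permute [Fintype A] (π : Equiv.Perm A) (P : WeakPref A) :
    (P.permute π).lift e = (P.lift e).permute (π.viaFintypeEmbedding e) := by
  have hrel : ((P.permute π).lift e).rel =
      ((P.lift e).permute (π.viaFintypeEmbedding e)).rel := by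
    funext a b
    have hsymm : ∀ x, (π.viaFintypeEmbedding e).symm (e x) = e (π.symm x) := fun x => by
      rw [Equiv.symm_apply_eq, Equiv.Perm.viaFintypeEmbedding_apply_image,
        Equiv.apply_symm_apply]
    have hsymm' : ∀ b, b ∉ Set.range e → (π.viaFintypeEmbedding e).symm b = b := fun b hb => by
      rw [Equiv.symm_apply_eq, Equiv.Perm.viaFintypeEmbedding_apply_notMem_range _ _ hb]
    by_cases hb : b ∈ Set.range e
    · obtain ⟨y, rfl⟩ := hb
      by_cases ha : a ∈ Set.range e
      · obtain ⟨x, rfl⟩ := ha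
        simp [WeakPref.permute, hsymm]
      · have hfalse : ∀ (Q : WeakPref A) (z : A), ¬ (Q.lift e).rel a (e z) := fun Q z h => by
          obtain ⟨x, hx, -⟩ := h z rfl
          exact ha ⟨x, hx.symm⟩
        simp only [WeakPref.permute, hsymm, hsymm' a ha, eq_iff_iff]
        exact iff_of_false (hfalse (P.permute π) y) (hfalse P (π.symm y))
    · simp only [WeakPref.permute, hsymm' b hb, eq_iff_iff]
      exact iff_of_true (lift_rel_of_notMem e (P.permute π) hb a)
        (lift_rel_of_notMem e P hb _)
  revert hrel
  generalize (P.permute π).lift e = Q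
  generalize (P.lift e).permute (π.viaFintypeEmbedding e) = Q'
  intro hrel
  cases Q
  cases Q'
  congr

/-- The rule induced on fewer voters and alternatives. -/
noncomputable def restrictRule (f : (W → WeakPref B) → B → ℝ) : (V → WeakPref A) → A → ℝ :=
  fun R => f (liftProfile d e R) ∘ e

variable {f : (W → WeakPref B) → B → ℝ}

theorem Anonymous.restrictRule [Fintype V] (h : Anonymous f) :
    Anonymous (restrictRule d e f : (V → WeakPref A) → A → ℝ) := by
  intro π R
  have key : liftProfile d e (fun i => R (π i)) =
      fun w => liftProfile d e R (π.viaFintypeEmbedding d w) := by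
    funext w
    by_cases hw : w ∈ Set.range d
    · obtain ⟨v, rfl⟩ := hw
      simp [Equiv.Perm.viaFintypeEmbedding_apply_image, liftProfile_apply]
    · rw [Equiv.Perm.viaFintypeEmbedding_apply_notMem_range _ _ hw]
      simp [liftProfile_of_notMem d e _ hw]
  funext x
  simp only [_root_.restrictRule, key]
  rw [h]

theorem Neutral.restrictRule [Fintype A] (h : Neutral f) :
    Neutral (restrictRule d e f : (V → WeakPref A) → A → ℝ) := by
  intro π R x
  have key : liftProfile d e (fun i => (R i).permute π) =
      fun w => (liftProfile d e R w).permute (π.viaFintypeEmbedding e) := by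
    funext w
    by_cases hw : w ∈ Set.range d
    · obtain ⟨v, rfl⟩ := hw
      simp [liftProfile_apply, WeakPref.lift_permute]
    · simp [liftProfile_of_notMem d e _ hw, WeakPref.permute, WeakPref.indifferent]
  have := h (π.viaFintypeEmbedding e) (liftProfile d e R) (e x)
  rw [Equiv.Perm.viaFintypeEmbedding_apply_image] at this
  simpa [_root_.restrictRule, key] using this

variable [Fintype B]

theorem probUC_lift_of_notMem (P : WeakPref A) (p : B → ℝ) {b : B} (hb : b ∉ Set.range e) :
    probUC p (P.lift e).rel b = ∑ a, p a := by
  simp [probUC, P.lift_rel_of_notMem e hb]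

variable [Fintype A]

theorem probUC_lift_apply (P : WeakPref A) (p : B → ℝ) (x : A) :
    probUC p (P.lift e).rel (e x) = probUC (p ∘ e) P.rel x := by
  have h : (univ.filter fun b => (P.lift e).rel b (e x)) =
      (univ.filter fun y => P.rel y x).map e := by
    ext b
    simp only [mem_filter, mem_univ, true_and, mem_map]
    constructor
    · intro hb
      obtain ⟨y, rfl, hy⟩ := hb x rfl
      exact ⟨y, hy, rfl⟩
    · rintro ⟨y, hy, rfl⟩
      exact (P.lift_rel_apply e y x).2 hy
  simp [probUC, h]

theorem SD_lift_iff (P : WeakPref A) {p q : B → ℝ} (hpq : ∑ b, p b = ∑ b, q b) :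
    SD (P.lift e).rel p q ↔ SD P.rel (p ∘ e) (q ∘ e) := by
  constructor
  · intro h x
    simpa [probUC_lift_apply] using h (e x)
  · intro h b
    by_cases hb : b ∈ Set.range e
    · obtain ⟨x, rfl⟩ := hb
      simpa [probUC_lift_apply] using h x
    · simp [probUC_lift_of_notMem e P _ hb, hpq]

theorem strictSD_lift_iff (P : WeakPref A) {p q : B → ℝ} (hpq : ∑ b, p b = ∑ b, q b) :
    StrictSD (P.lift e).rel p q ↔ StrictSD P.rel (p ∘ e) (q ∘ e) := by
  refine and_congr (SD_lift_iff e P hpq) ⟨?_, ?_⟩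
  · rintro ⟨b, hb⟩
    by_cases hbe : b ∈ Set.range e
    · obtain ⟨x, rfl⟩ := hbe
      exact ⟨x, by simpa [probUC_lift_apply] using hb⟩
    · simp [probUC_lift_of_notMem e P _ hbe, hpq] at hb
  · rintro ⟨x, hx⟩
    exact ⟨e x, by simpa [probUC_lift_apply] using hx⟩

theorem SD_liftProfile (R : V → WeakPref A) {p q : B → ℝ} (hpq : ∑ b, p b = ∑ b, q b)
    (h : ∀ v, SD (R v).rel (p ∘ e) (q ∘ e)) (w : W) : SD (liftProfile d e R w).rel p q := by
  by_cases hw : w ∈ Set.range d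
  · obtain ⟨v, rfl⟩ := hw
    rw [liftProfile_apply]
    exact (SD_lift_iff e _ hpq).2 (h v)
  · intro b
    simp [liftProfile_of_notMem d e R hw, WeakPref.indifferent, probUC, hpq]

/-- An efficient rule gives no probability to unanimously bottom-ranked alternatives. -/
theorem ExAnteEfficient.eq_zero_of_notMem_range [Nonempty A] [Nonempty V]
    (hf : ∀ R, IsLottery (f R)) (heff : ExAnteEfficient f) (R : V → WeakPref A) {b : B}
    (hb : b ∉ Set.range e) : f (liftProfile d e R) b = 0 := by
  set p := f (liftProfile d e R) with hp
  obtain ⟨hp0, hp1⟩ := hf (liftProfile d e R)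
  rw [← hp] at hp0 hp1
  by_contra hne
  have hpos : 0 < p b := lt_of_le_of_ne (hp0 b) (Ne.symm hne)
  obtain ⟨x₀⟩ := ‹Nonempty A›
  obtain ⟨v₀⟩ := ‹Nonempty V›
  let q : B → ℝ := fun y => p y + ((if y = e x₀ then p b else 0) - if y = b then p b else 0)
  have hqe : ∀ x, (q ∘ e) x = (p ∘ e) x + if x = x₀ then p b else 0 := by
    intro x
    have : e x ≠ b := fun h => hb ⟨x, h⟩
    simp [q, this]
  have hq1 : ∑ y, q y = 1 := by
    simp [q, sum_add_distrib, hp1]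
  have hle : ∀ x, (p ∘ e) x ≤ (q ∘ e) x := by
    intro x
    rw [hqe]
    split_ifs <;> linarith
  have hSD : ∀ v, SD (R v).rel (q ∘ e) (p ∘ e) := fun v x => sum_le_sum fun y _ => hle y
  have hpq : ∑ y, q y = ∑ y, p y := hq1.trans hp1.symm
  refine heff (liftProfile d e R) ⟨q, ⟨fun y => ?_, hq1⟩, SD_liftProfile d e R hpq hSD, d v₀, ?_⟩
  · have := hp0 y
    by_cases hy : y = b
    · have : b ≠ e x₀ := fun h => hb ⟨x₀, h.symm⟩
      simp [q, hy, this]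
    · simp only [q, if_neg hy]
      split_ifs <;> linarith
  · rw [liftProfile_apply]
    refine (strictSD_lift_iff e _ hpq).2 ⟨hSD v₀, x₀, ?_⟩
    refine sum_lt_sum (fun y _ => hle y) ⟨x₀, ?_, ?_⟩
    · simpa using (R v₀).total x₀ x₀
    · rw [hqe]
      simpa using hpos

theorem isLottery_restrictRule [Nonempty A] [Nonempty V] (hf : ∀ R, IsLottery (f R))
    (heff : ExAnteEfficient f) (R : V → WeakPref A) : IsLottery (restrictRule d e f R) := by
  refine ⟨fun x => (hf _).1 _, ?_⟩
  rw [← (hf (liftProfile d e R)).2]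
  exact Fintype.sum_of_injective e e.injective _ _
    (fun b hb => heff.eq_zero_of_notMem_range d e hf R hb) fun _ => rfl

theorem ExAnteEfficient.restrictRule (hf : ∀ R, IsLottery (f R)) (heff : ExAnteEfficient f) :
    ExAnteEfficient (restrictRule d e f : (V → WeakPref A) → A → ℝ) := by
  rintro R ⟨q, ⟨hq0, hq1⟩, hSD, v, hstrict⟩
  have hqe : Function.extend e q 0 ∘ e = q := funext (e.injective.extend_apply q 0)
  have hq1' : ∑ b, Function.extend e q 0 b = 1 := by
    rw [← hq1]
    refine (Fintype.sum_of_injective e e.injective _ _ (fun b hb => ?_) fun x => ?_).symm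
    · exact Function.extend_apply' _ _ _ hb
    · exact (e.injective.extend_apply _ _ _).symm
  have hsum := hq1'.trans (hf (liftProfile d e R)).2.symm
  refine heff (liftProfile d e R) ⟨Function.extend e q 0, ⟨fun b => ?_, hq1'⟩,
    SD_liftProfile d e R hsum (by rw [hqe]; exact hSD), d v, ?_⟩
  · by_cases hb : b ∈ Set.range e
    · obtain ⟨x, rfl⟩ := hb
      rw [e.injective.extend_apply]
      exact hq0 x
    · rw [Function.extend_apply' _ _ _ hb]
      rfl
  · rw [liftProfile_apply, strictSD_lift_iff e _ hsum, hqe]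
    exact hstrict

theorem WeakSP.restrictRule (hf : ∀ R, IsLottery (f R)) (h : WeakSP f) :
    WeakSP (restrictRule d e f : (V → WeakPref A) → A → ℝ) := by
  intro R R' i hR hstrict
  refine h (liftProfile d e R) (liftProfile d e R') (d i) (fun w hw => ?_) ?_
  · by_cases hwd : w ∈ Set.range d
    · obtain ⟨v, rfl⟩ := hwd
      rw [liftProfile_apply, liftProfile_apply, hR v fun hv => hw (by rw [hv])]
    · rw [liftProfile_of_notMem d e _ hwd, liftProfile_of_notMem d e _ hwd]
  · rw [liftProfile_apply]
    exact (strictSD_lift_iff e _ ((hf _).2.trans (hf _).2.symm)).2 hstrict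

end Lift

/-- The profile given by a table of ranks. -/
def rankProfile {A V : Type*} (T : V → A → ℕ) : V → WeakPref A := fun i => WeakPref.ofRank (T i)

section RankProfile

variable {A V : Type*} [Fintype A] {f : (V → WeakPref A) → A → ℝ}

theorem probUC_rankProfile (T : V → A → ℕ) (p : A → ℝ) (i : V) (x : A) :
    probUC p (rankProfile T i).rel x = ∑ y with T i y ≤ T i x, p y := by
  refine sum_congr (Finset.ext fun y => mem_filter.trans ?_) fun _ _ => rfl
  rw [mem_filter]
  rfl

theorem rankProfile_symmetry [Finite V] (hanon : Anonymous f) (hneut : Neutral f) (T : V → A → ℕ)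
    (σ : V → V) (π : A → A) (hσ : σ.Injective) (hπ : π.Injective) (x : A) :
    f (rankProfile fun i y => T (σ i) (π y)) x = f (rankProfile T) (π x) := by
  let σ' : Equiv.Perm V := Equiv.ofBijective σ (Finite.injective_iff_bijective.1 hσ)
  let π' : Equiv.Perm A := Equiv.ofBijective π (Finite.injective_iff_bijective.1 hπ)
  have h₁ : (fun i => (rankProfile (fun i y => T (σ i) (π y)) i).permute π') =
      fun i => rankProfile T (σ' i) := by
    funext i
    have : ∀ a, π (π'.symm a) = a := π'.apply_symm_apply
    simp only [rankProfile, WeakPref.permute, WeakPref.ofRank, this]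
    rfl
  rw [← hneut π', h₁, hanon]
  rfl

theorem eq_of_rankProfile_symmetry [Finite V] (hanon : Anonymous f) (hneut : Neutral f)
    (T : V → A → ℕ) (σ : V → V) (π : A → A) (hσ : σ.Injective) (hπ : π.Injective)
    (h : ∀ i y, T i y = T (σ i) (π y)) (x : A) :
    f (rankProfile T) x = f (rankProfile T) (π x) := by
  have : T = fun i y => T (σ i) (π y) := by
    funext i y
    exact h i y
  rw [← rankProfile_symmetry hanon hneut T σ π hσ hπ x, ← this]

/-- If voter `i` can move from `T` to a relabelling of `T'`, then no weak stochastic improvement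
for that voter is strict. -/
theorem WeakSP.rankProfile [Finite V] (hsp : WeakSP f) (hanon : Anonymous f) (hneut : Neutral f)
    (T T' : V → A → ℕ) (i : V) (r : A → ℕ) (hr : T i = r) (σ : V → V) (π : A → A)
    (hσ : σ.Injective) (hπ : π.Injective) (h : ∀ j, j ≠ i → ∀ y, T j y = T' (σ j) (π y))
    (hle : ∀ x, ∑ y with r y ≤ r x, f (rankProfile T) y ≤
      ∑ y with r y ≤ r x, f (rankProfile T') (π y)) (x : A) :
    ∑ y with r y ≤ r x, f (rankProfile T') (π y) ≤ ∑ y with r y ≤ r x, f (rankProfile T) y := by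
  subst hr
  by_contra! hlt
  have hS : f (_root_.rankProfile fun i y => T' (σ i) (π y)) =
      fun x => f (_root_.rankProfile T') (π x) :=
    funext (rankProfile_symmetry hanon hneut T' σ π hσ hπ)
  refine hsp (_root_.rankProfile T) (_root_.rankProfile fun i y => T' (σ i) (π y)) i
    (fun j hj => congrArg WeakPref.ofRank (funext (h j hj))) ?_
  rw [hS]
  exact ⟨fun x => (probUC_rankProfile ..).trans_le ((hle x).trans_eq (probUC_rankProfile ..).symm),
    x, (probUC_rankProfile ..).trans_lt (hlt.trans_eq (probUC_rankProfile ..).symm)⟩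

/-- If shifting probability along `w` is a weak improvement for all voters and a strict one for
some voter, then some alternative that loses probability has none to begin with. -/
theorem ExAnteEfficient.exists_eq_zero (heff : ExAnteEfficient f) (hf : ∀ R, IsLottery (f R))
    (T : V → A → ℕ) (w : A → ℤ) (hw : ∑ x, w x = 0)
    (hle : ∀ i x, 0 ≤ ∑ y with T i y ≤ T i x, w y)
    (hlt : ∃ i x, 0 < ∑ y with T i y ≤ T i x, w y) :
    ∃ x, w x < 0 ∧ f (rankProfile T) x = 0 := by
  by_contra! hne
  set p := f (rankProfile T) with hp
  obtain ⟨hp0, hp1⟩ := hf (rankProfile T)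
  rw [← hp] at hp0 hp1
  have hev : ∀ᶠ ε : ℝ in nhdsWithin 0 (Set.Ioi 0), ∀ x, 0 ≤ p x + ε * w x := by
    refine Filter.eventually_all.2 fun x => ?_
    rcases lt_or_ge (w x) 0 with hx | hx
    · have hpos : 0 < p x := lt_of_le_of_ne (hp0 x) (hne x hx).symm
      have hc : Filter.Tendsto (fun ε : ℝ => p x + ε * w x) (nhdsWithin 0 (Set.Ioi 0))
          (nhds (p x + 0 * w x)) :=
        (Continuous.tendsto (by fun_prop) 0).mono_left nhdsWithin_le_nhds
      rw [zero_mul, add_zero] at hc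
      exact (hc.eventually (lt_mem_nhds hpos)).mono fun _ h => h.le
    · filter_upwards [self_mem_nhdsWithin] with ε hε
      have h₁ : (0 : ℝ) < ε := hε
      have h₂ : (0 : ℝ) ≤ w x := by exact_mod_cast hx
      have := hp0 x
      positivity
  obtain ⟨ε, hq0, hε⟩ := (hev.and self_mem_nhdsWithin).exists
  have hε' : (0 : ℝ) < ε := hε
  have hsum : ∀ i x, probUC (fun y => p y + ε * w y) (rankProfile T i).rel x =
      probUC p (rankProfile T i).rel x + ε * ((∑ y with T i y ≤ T i x, w y : ℤ) : ℝ) := by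
    intro i x
    simp only [probUC_rankProfile, sum_add_distrib, ← mul_sum, Int.cast_sum]
  have hSD : ∀ i, SD (rankProfile T i).rel (fun y => p y + ε * w y) p := by
    intro i x
    have : (0 : ℝ) ≤ ((∑ y with T i y ≤ T i x, w y : ℤ) : ℝ) := by exact_mod_cast hle i x
    rw [hsum]
    nlinarith [mul_nonneg hε'.le this]
  obtain ⟨i, x, hix⟩ := hlt
  refine heff (rankProfile T) ⟨fun y => p y + ε * w y, ⟨hq0, ?_⟩, hSD, i, hSD i, x, ?_⟩
  · have : ∑ x, (w x : ℝ) = 0 := by exact_mod_cast hw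
    rw [sum_add_distrib, ← mul_sum, this, hp1, mul_zero, add_zero]
  · have : (0 : ℝ) < ((∑ y with T i y ≤ T i x, w y : ℤ) : ℝ) := by exact_mod_cast hix
    rw [hsum]
    nlinarith [mul_pos hε' this]

end RankProfile

/-- The rank tables of the profiles used in the impossibility proof. -/
def rankTable : Fin 11 → Fin 4 → Fin 4 → ℕ :=
  ![![![1, 1, 0, 0], ![1, 1, 0, 0], ![1, 0, 1, 0], ![1, 1, 0, 2]],
    ![![1, 1, 0, 0], ![1, 1, 0, 0], ![1, 0, 1, 0], ![1, 0, 1, 2]],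
    ![![1, 1, 0, 0], ![1, 1, 0, 0], ![1, 1, 2, 0], ![1, 0, 1, 2]],
    ![![1, 1, 0, 0], ![1, 1, 0, 0], ![0, 0, 1, 1], ![1, 0, 2, 1]],
    ![![1, 1, 0, 0], ![1, 1, 0, 0], ![1, 0, 2, 1], ![1, 0, 1, 2]],
    ![![1, 1, 0, 0], ![1, 0, 1, 0], ![0, 1, 1, 0], ![2, 0, 0, 1]],
    ![![1, 1, 0, 0], ![1, 0, 1, 0], ![1, 2, 1, 0], ![2, 0, 0, 1]],
    ![![1, 1, 0, 0], ![1, 0, 1, 0], ![1, 2, 1, 0], ![1, 1, 0, 2]],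
    ![![1, 1, 0, 0], ![1, 0, 1, 0], ![0, 2, 0, 1], ![0, 0, 2, 1]],
    ![![1, 1, 0, 0], ![2, 0, 1, 0], ![2, 1, 0, 1], ![0, 0, 1, 1]],
    ![![1, 1, 0, 0], ![2, 0, 1, 0], ![0, 0, 1, 1], ![0, 1, 0, 2]]]

set_option maxHeartbeats 1000000 in
/-- The impossibility for four voters and four alternatives. -/
theorem not_exists_rule_four_four (f : (Fin 4 → WeakPref (Fin 4)) → Fin 4 → ℝ)
    (hf : ∀ R, IsLottery (f R)) (hanon : Anonymous f) (hneut : Neutral f)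
    (heff : ExAnteEfficient f) (hsp : WeakSP f) : False := by
  obtain ⟨p, hp⟩ : ∃ p : Fin 11 → Fin 4 → ℝ, ∀ k, f (rankProfile (rankTable k)) = p k :=
    ⟨_, fun _ => rfl⟩
  have nonneg : ∀ k x, 0 ≤ p k x := fun k => hp k ▸ (hf _).1
  have sum_one : ∀ k, p k 0 + p k 1 + p k 2 + p k 3 = 1 := fun k => by
    simpa [hp, Fin.sum_univ_four] using (hf (rankProfile (rankTable k))).2
  have symm := fun k => eq_of_rankProfile_symmetry hanon hneut (rankTable k)
  have eff := fun k => heff.exists_eq_zero hf (rankTable k)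
  have move := fun k l => hsp.rankProfile hanon hneut (rankTable k) (rankTable l)
  simp only [hp] at symm eff move
  have sym10 := symm 10 ![2, 3, 0, 1] ![3, 2, 1, 0] (by decide) (by decide) (by decide)
  simp [Fin.forall_fin_succ] at sym10
  have eff10 := eff 10 ![-1, 1, 1, -1] (by decide) (by decide) (by decide)
  simp [Fin.exists_fin_succ] at eff10
  have sym8 := symm 8 ![1, 0, 3, 2] ![0, 2, 1, 3] (by decide) (by decide) (by decide)
  simp [Fin.forall_fin_succ] at sym8
  have eff8 := eff 8 ![1, -1, -1, 1] (by decide) (by decide) (by decide)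
  simp [Fin.exists_fin_succ] at eff8
  have sym5 := symm 5 ![1, 0, 2, 3] ![0, 2, 1, 3] (by decide) (by decide) (by decide)
  simp [Fin.forall_fin_succ] at sym5
  have eff5 := eff 5 ![-1, 0, 0, 1] (by decide) (by decide) (by decide)
  simp [Fin.exists_fin_succ] at eff5
  have h5_8 := move 5 8 0 ![1, 1, 0, 0] (by decide) ![3, 0, 1, 2] ![1, 2, 0, 3]
    (by decide) (by decide) (by decide)
  simp [Fin.forall_fin_succ, sum_filter, Fin.sum_univ_four] at h5_8
  have eff6 := eff 6 ![-1, 0, 0, 1] (by decide) (by decide) (by decide)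
  simp [Fin.exists_fin_succ] at eff6
  have h6_5 := move 6 5 2 ![1, 2, 1, 0] (by decide) ![0, 1, 2, 3] ![0, 1, 2, 3]
    (by decide) (by decide) (by decide)
  simp [Fin.forall_fin_succ, sum_filter, Fin.sum_univ_four] at h6_5
  have eff7 := eff 7 ![-1, 0, 1, 0] (by decide) (by decide) (by decide)
  simp [Fin.exists_fin_succ] at eff7
  have h6_7 := move 6 7 3 ![2, 0, 0, 1] (by decide) ![0, 1, 2, 3] ![0, 1, 2, 3]
    (by decide) (by decide) (by decide)
  simp [Fin.forall_fin_succ, sum_filter, Fin.sum_univ_four] at h6_7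
  have eff1 := eff 1 ![-1, 0, 1, 0] (by decide) (by decide) (by decide)
  simp [Fin.exists_fin_succ] at eff1
  have h1_7 := move 1 7 0 ![1, 1, 0, 0] (by decide) ![2, 1, 0, 3] ![0, 2, 1, 3]
    (by decide) (by decide) (by decide)
  simp [Fin.forall_fin_succ, sum_filter, Fin.sum_univ_four] at h1_7
  have eff2 := eff 2 ![-1, 1, 0, 0] (by decide) (by decide) (by decide)
  simp [Fin.exists_fin_succ] at eff2
  have h2_7 := move 2 7 0 ![1, 1, 0, 0] (by decide) ![0, 1, 2, 3] ![0, 2, 1, 3]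
    (by decide) (by decide) (by decide)
  simp [Fin.forall_fin_succ, sum_filter, Fin.sum_univ_four] at h2_7
  have sym4 := symm 4 ![0, 1, 3, 2] ![0, 1, 3, 2] (by decide) (by decide) (by decide)
  simp [Fin.forall_fin_succ] at sym4
  have eff4 := eff 4 ![-1, 1, 0, 0] (by decide) (by decide) (by decide)
  simp [Fin.exists_fin_succ] at eff4
  have h1_4 := move 1 4 2 ![1, 0, 1, 0] (by decide) ![0, 1, 2, 3] ![0, 1, 2, 3]
    (by decide) (by decide) (by decide)
  simp [Fin.forall_fin_succ, sum_filter, Fin.sum_univ_four] at h1_4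
  have h2_4 := move 2 4 2 ![1, 1, 2, 0] (by decide) ![0, 1, 2, 3] ![0, 1, 2, 3]
    (by decide) (by decide) (by decide)
  simp [Fin.forall_fin_succ, sum_filter, Fin.sum_univ_four] at h2_4
  have h1_0 := move 1 0 3 ![1, 0, 1, 2] (by decide) ![0, 1, 2, 3] ![0, 1, 2, 3]
    (by decide) (by decide) (by decide)
  simp [Fin.forall_fin_succ, sum_filter, Fin.sum_univ_four] at h1_0
  have h2_0 := move 2 0 3 ![1, 0, 1, 2] (by decide) ![0, 1, 3, 2] ![0, 1, 3, 2]
    (by decide) (by decide) (by decide)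
  simp [Fin.forall_fin_succ, sum_filter, Fin.sum_univ_four] at h2_0
  have eff9 := eff 9 ![-1, 1, 0, 0] (by decide) (by decide) (by decide)
  simp [Fin.exists_fin_succ] at eff9
  have h9_10 := move 9 10 2 ![2, 1, 0, 1] (by decide) ![0, 1, 3, 2] ![0, 1, 2, 3]
    (by decide) (by decide) (by decide)
  simp [Fin.forall_fin_succ, sum_filter, Fin.sum_univ_four] at h9_10
  have eff3 := eff 3 ![-1, 1, 0, 0] (by decide) (by decide) (by decide)
  simp [Fin.exists_fin_succ] at eff3
  have eff3' := eff 3 ![0, 0, -1, 1] (by decide) (by decide) (by decide)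
  simp [Fin.exists_fin_succ] at eff3'
  have h9_3 := move 9 3 1 ![2, 0, 1, 0] (by decide) ![2, 0, 3, 1] ![2, 3, 1, 0]
    (by decide) (by decide) (by decide)
  simp [Fin.forall_fin_succ, sum_filter, Fin.sum_univ_four] at h9_3
  have h4_3 := move 4 3 2 ![1, 0, 2, 1] (by decide) ![0, 1, 2, 3] ![0, 1, 3, 2]
    (by decide) (by decide) (by decide)
  simp [Fin.forall_fin_succ, sum_filter, Fin.sum_univ_four] at h4_3
  have a10 : p 10 0 = 0 ∧ p 10 1 + p 10 2 + p 10 3 = 1 ∧ p 10 2 = 1 / 2 := by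
    have := sum_one 10
    rcases eff10 with h | h <;> refine ⟨?_, ?_, ?_⟩ <;> linarith
  have a8 : p 8 0 + p 8 3 = 1 := by
    have := sum_one 8
    rcases eff8 with h | h <;> linarith
  have a5 : p 5 1 = 0 ∧ p 5 2 = 0 ∧ p 5 3 = 1 := by
    have h₀ := sum_one 5
    have h₁ := nonneg 5 1
    have h₂ := (h5_8 (by linarith [sum_one 8]) (by linarith)).2
    refine ⟨?_, ?_, ?_⟩ <;> linarith
  have a6 : p 6 1 = 0 ∧ p 6 2 = 0 ∧ p 6 3 = 1 := by
    have h₀ := sum_one 6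
    have h₁ := nonneg 6 1
    have h₂ := nonneg 6 2
    have h₃ := (h6_5 (by linarith) (by linarith) (by linarith) (by linarith)).2.2.2
    refine ⟨?_, ?_, ?_⟩ <;> linarith
  have a7 : p 7 3 = 1 ∧ p 7 1 = 0 := by
    have h₀ := sum_one 7
    have h₁ := nonneg 7 1
    have h₂ := nonneg 7 2
    have h₃ := (h6_7 (by linarith) (by linarith) (by linarith)).2.1
    constructor <;> linarith
  have a1 : p 1 1 = 0 := by
    have h₀ := sum_one 1
    have h₁ := nonneg 1 1
    have h₂ := (h1_7 (by linarith [sum_one 7]) (by linarith)).2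
    linarith
  have a2 : p 2 1 = 0 := by
    have h₀ := sum_one 2
    have h₁ := nonneg 2 1
    have h₂ := (h2_7 (by linarith [sum_one 7]) (by linarith)).2
    linarith
  have s0 := sum_one 0
  have s1 := sum_one 1
  have s2 := sum_one 2
  have s4 := sum_one 4
  have b1_4 : p 1 2 ≤ p 4 2 := by
    by_contra! h
    have := (h1_4 (by linarith) (by linarith) (by linarith) (by linarith)).2.1
    linarith
  have b1_0 : 1 - p 0 3 ≤ p 1 2 := by
    by_contra! h
    have := (h1_0 (by linarith) (by linarith [nonneg 0 1]) (by linarith) (by linarith)).1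
    linarith
  have b2_0 : 1 - p 0 2 ≤ p 2 2 := by
    by_contra! h
    have := (h2_0 (by linarith) (by linarith [nonneg 0 1]) (by linarith) (by linarith)).1
    linarith
  have a4 : p 4 1 = 0 := by
    have h₀ : p 2 3 ≤ p 4 3 := by linarith [nonneg 0 0, nonneg 0 1]
    have h₁ := nonneg 4 1
    have h₂ := (h2_4 (by linarith) (by linarith) h₀).1
    linarith
  have s9 := sum_one 9
  have s3 := sum_one 3
  have a9 : 1 / 2 ≤ p 9 2 := by
    by_contra! h
    have := (h9_10 (by linarith) (by linarith) (by linarith) (by linarith)).2.2.1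
    linarith
  have a3 : 1 / 2 ≤ p 3 1 := by
    by_contra! h
    have := (h9_3 (by linarith) (by linarith) (by linarith) (by linarith)).2.1
    linarith
  have := (h4_3 (by linarith) (by linarith) (by linarith) (by linarith)).2.1
  linarith

/-- For `n ≥ 4` voters and `m ≥ 4` alternatives, no anonymous and neutral SDS on weak
preference profiles satisfies ex ante efficiency and weak strategyproofness. -/
theorem no_anonymous_neutral_exAnte_weakSP (n m : ℕ) (hn : 4 ≤ n) (hm : 4 ≤ m) :
    ¬ ∃ f : (Fin n → WeakPref (Fin m)) → Fin m → ℝ,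
        (∀ R, IsLottery (f R)) ∧ Anonymous f ∧ Neutral f ∧
        ExAnteEfficient f ∧ WeakSP f := by
  rintro ⟨f, hf, hanon, hneut, heff, hsp⟩
  let d : Fin 4 ↪ Fin n := Fin.castLEEmb hn
  let e : Fin 4 ↪ Fin m := Fin.castLEEmb hm
  exact not_exists_rule_four_four (restrictRule d e f) (isLottery_restrictRule d e hf heff)
    (hanon.restrictRule d e) (hneut.restrictRule d e) (heff.restrictRule d e hf)
    (hsp.restrictRule d e hf)
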